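/- In the setting above, Z₁ = K₁ (the center of the Weyl algebra division ring D_p over k̄ of characteristic p is the rational function field k̄(x_i^p, y_i^p)), and for m ≥ 2, Z_m = K_m + p·Z_{m-1} under the natural identification; consequently, the image of Z_m under reduction modulo p in D_p equals the subfield Z^{p^{m-1}} = k̄(x_i^{p^m}, y_i^{p^m}). -/

import Mathlib

/-- The defining relations of the `n`-th Weyl algebra over `F`:
`x_i x_j = x_j x_i`, `y_i y_j = y_j y_i`, `y_i x_j = x_j y_i + δ_{ij}`. -/
inductive WeylRel (F : Type*) [CommRing F] (n : ℕ) :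
    FreeAlgebra F (Fin n ⊕ Fin n) → FreeAlgebra F (Fin n ⊕ Fin n) → Prop
  | xx (i j : Fin n) : WeylRel F n
      (FreeAlgebra.ι F (Sum.inl i) * FreeAlgebra.ι F (Sum.inl j))
      (FreeAlgebra.ι F (Sum.inl j) * FreeAlgebra.ι F (Sum.inl i))
  | yy (i j : Fin n) : WeylRel F n
      (FreeAlgebra.ι F (Sum.inr i) * FreeAlgebra.ι F (Sum.inr j))
      (FreeAlgebra.ι F (Sum.inr j) * FreeAlgebra.ι F (Sum.inr i))
  | yx (i j : Fin n) : WeylRel F n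
      (FreeAlgebra.ι F (Sum.inr i) * FreeAlgebra.ι F (Sum.inl j))
      (FreeAlgebra.ι F (Sum.inl j) * FreeAlgebra.ι F (Sum.inr i) + if i = j then 1 else 0)

/-- The `n`-th Weyl algebra `A_n(F)`. -/
def WeylAlgebra (F : Type*) [CommRing F] (n : ℕ) := RingQuot (WeylRel F n)

noncomputable instance (F : Type*) [CommRing F] (n : ℕ) : Ring (WeylAlgebra F n) :=
  inferInstanceAs (Ring (RingQuot (WeylRel F n)))

noncomputable instance (F : Type*) [CommRing F] (n : ℕ) : Algebra F (WeylAlgebra F n) :=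
  inferInstanceAs (Algebra F (RingQuot (WeylRel F n)))

/-- The generator `x_i` of the Weyl algebra. -/
noncomputable def WeylAlgebra.X {F : Type*} [CommRing F] {n : ℕ} (i : Fin n) : WeylAlgebra F n :=
  RingQuot.mkAlgHom F (WeylRel F n) (FreeAlgebra.ι F (Sum.inl i))

/-- The generator `y_i` of the Weyl algebra. -/
noncomputable def WeylAlgebra.Y {F : Type*} [CommRing F] {n : ℕ} (i : Fin n) : WeylAlgebra F n :=
  RingQuot.mkAlgHom F (WeylRel F n) (FreeAlgebra.ι F (Sum.inr i))


/-- The `m`-truncated Witt ring `W_{m,p} = W(k)/(pᵐ)`. -/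
abbrev TruncWitt (p : ℕ) [Fact p.Prime] (k : Type*) [CommRing k] (m : ℕ) :=
  WittVector p k ⧸ Ideal.span {(p : WittVector p k) ^ m}

/-- The full localization of the Weyl algebra `A_n(F)` at the Ore set of
non-zero-divisors. -/
abbrev WeylLoc (F : Type*) [CommRing F] (n : ℕ)
    [OreLocalization.OreSet (nonZeroDivisors (WeylAlgebra F n))] :=
  OreLocalization (nonZeroDivisors (WeylAlgebra F n)) (WeylAlgebra F n)

/-- The image of the generator `xᵢ` in the localized Weyl algebra. -/
noncomputable def locX (F : Type*) [CommRing F] (n : ℕ)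
    [OreLocalization.OreSet (nonZeroDivisors (WeylAlgebra F n))] (i : Fin n) : WeylLoc F n :=
  OreLocalization.numeratorRingHom (WeylAlgebra.X i)

/-- The image of the generator `yᵢ` in the localized Weyl algebra. -/
noncomputable def locY (F : Type*) [CommRing F] (n : ℕ)
    [OreLocalization.OreSet (nonZeroDivisors (WeylAlgebra F n))] (i : Fin n) : WeylLoc F n :=
  OreLocalization.numeratorRingHom (WeylAlgebra.Y i)

/-- The smallest subring of `D` containing `S` and closed under taking (two-sided)
inverses of its elements. -/
def divClosure {D : Type*} [Ring D] (S : Set D) : Subring D :=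
  sInf {T : Subring D | S ⊆ T ∧ ∀ x ∈ T, ∀ y : D, x * y = 1 → y * x = 1 → y ∈ T}

/-- `F(xᵢ^q, yᵢ^q)`: the inverse-closed subring of the localized Weyl algebra generated by
the scalars `F` and the `q`-th powers of the generators. -/
noncomputable def ratSubfield (F : Type*) [CommRing F] (n : ℕ)
    [OreLocalization.OreSet (nonZeroDivisors (WeylAlgebra F n))] (q : ℕ) :
    Subring (WeylLoc F n) :=
  divClosure (Set.range (algebraMap F (WeylLoc F n)) ∪
    Set.range (fun i : Fin n => locX F n i ^ q) ∪
    Set.range (fun i : Fin n => locY F n i ^ q))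

namespace WeylAlgebra

open MvPolynomial

variable {F : Type*} [CommRing F] {n : ℕ}

theorem X_mul_X (i j : Fin n) : (X i * X j : WeylAlgebra F n) = X j * X i := by
  have := RingQuot.mkAlgHom_rel F (WeylRel.xx (F := F) i j)
  rwa [map_mul, map_mul] at this

theorem Y_mul_Y (i j : Fin n) : (Y i * Y j : WeylAlgebra F n) = Y j * Y i := by
  have := RingQuot.mkAlgHom_rel F (WeylRel.yy (F := F) i j)
  rwa [map_mul, map_mul] at this

theorem Y_mul_X (i j : Fin n) :
    (Y i * X j : WeylAlgebra F n) = X j * Y i + if i = j then 1 else 0 := by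
  have := RingQuot.mkAlgHom_rel F (WeylRel.yx (F := F) i j)
  rw [map_mul, map_add, map_mul, apply_ite (RingQuot.mkAlgHom F (WeylRel F n)), map_one,
    map_zero] at this
  exact this

@[elab_as_elim]
theorem induction {motive : WeylAlgebra F n → Prop}
    (algebraMap : ∀ r, motive (algebraMap F _ r)) (X : ∀ i, motive (X i)) (Y : ∀ i, motive (Y i))
    (mul : ∀ a b, motive a → motive b → motive (a * b))
    (add : ∀ a b, motive a → motive b → motive (a + b)) (a : WeylAlgebra F n) : motive a := by
  obtain ⟨a, rfl⟩ := RingQuot.mkAlgHom_surjective F (WeylRel F n) a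
  induction a using FreeAlgebra.induction with
  | grade0 r => rw [AlgHom.commutes]; exact algebraMap r
  | grade1 i => cases i with
    | inl i => exact X i
    | inr i => exact Y i
  | mul a b ha hb => rw [map_mul]; exact mul _ _ ha hb
  | add a b ha hb => rw [map_add]; exact add _ _ ha hb

theorem pderiv_pderiv_comm {σ : Type*} (i j : σ) (f : MvPolynomial σ F) :
    pderiv i (pderiv j f) = pderiv j (pderiv i f) := by
  classical
  induction f using MvPolynomial.induction_on with
  | C r => simp
  | add f g hf hg => simp [hf, hg]
  | mul_X f l hf =>
    simp only [pderiv_mul, map_add, hf, pderiv_X, Pi.single_apply]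
    split_ifs <;> simp only [map_zero, pderiv_one, mul_zero, mul_one, add_zero] <;> ring

/-- The action of the generators on polynomials: `xᵢ` acts by multiplication, `yᵢ` by
multiplication plus `∂/∂xᵢ`. -/
noncomputable def genAction (F : Type*) [CommRing F] (n : ℕ) :
    Fin n ⊕ Fin n → Module.End F (MvPolynomial (Fin n ⊕ Fin n) F)
  | .inl i => LinearMap.mulLeft F (MvPolynomial.X (Sum.inl i))
  | .inr i => LinearMap.mulLeft F (MvPolynomial.X (Sum.inr i)) +
      (pderiv (Sum.inl i : Fin n ⊕ Fin n)).toLinearMap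

/-- The action of the Weyl algebra on polynomials. -/
noncomputable def action (F : Type*) [CommRing F] (n : ℕ) :
    WeylAlgebra F n →ₐ[F] Module.End F (MvPolynomial (Fin n ⊕ Fin n) F) :=
  RingQuot.liftAlgHom F ⟨FreeAlgebra.lift F (genAction F n), by
    intro a b h
    induction h with
    | xx i j =>
      refine LinearMap.ext fun f => ?_
      simp [genAction]; ring
    | yy i j =>
      refine LinearMap.ext fun f => ?_
      simp [genAction, pderiv_X]
      rw [pderiv_pderiv_comm (Sum.inl i) (Sum.inl j) f]
      ring
    | yx i j =>
      refine LinearMap.ext fun f => ?_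
      split_ifs with h
      · subst h
        simp [genAction, pderiv_X]; ring
      · simp [genAction, pderiv_X, Ne.symm h]; ring⟩

theorem action_X (i : Fin n) (f : MvPolynomial (Fin n ⊕ Fin n) F) :
    action F n (X i) f = MvPolynomial.X (Sum.inl i) * f := by
  have : action F n (X i) = genAction F n (Sum.inl i) := by
    unfold action X
    exact (RingQuot.liftAlgHom_mkAlgHom_apply ..).trans (FreeAlgebra.lift_ι_apply ..)
  rw [this]; rfl

theorem action_Y (i : Fin n) (f : MvPolynomial (Fin n ⊕ Fin n) F) :
    action F n (Y i) f = MvPolynomial.X (Sum.inr i) * f + pderiv (Sum.inl i) f := by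
  have : action F n (Y i) = genAction F n (Sum.inr i) := by
    unfold action Y
    exact (RingQuot.liftAlgHom_mkAlgHom_apply ..).trans (FreeAlgebra.lift_ι_apply ..)
  rw [this]; rfl

theorem action_mul_X_inr (a : WeylAlgebra F n) (j : Fin n) :
    ∀ f : MvPolynomial (Fin n ⊕ Fin n) F,
      action F n a (f * MvPolynomial.X (Sum.inr j)) =
        action F n a f * MvPolynomial.X (Sum.inr j) := by
  induction a using induction with
  | algebraMap r => intro f; simp
  | X i => intro f; simp only [action_X]; ring
  | Y i => intro f; simp [action_Y, pderiv_X]; ring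
  | mul a b ha hb => intro f; simp [ha, hb]
  | add a b ha hb => intro f; simp [ha, hb, add_mul]

theorem exists_algHom_X {σ A : Type*} [Ring A] [Algebra F A] (a : σ → A)
    (h : ∀ i j, a i * a j = a j * a i) :
    ∃ g : MvPolynomial σ F →ₐ[F] A, ∀ i, g (MvPolynomial.X i) = a i := by
  have hcomm := Algebra.isMulCommutative_adjoin F (s := Set.range a) (by
    rintro _ ⟨i, rfl⟩ _ ⟨j, rfl⟩; exact h i j)
  let _ : CommRing (Algebra.adjoin F (Set.range a)) :=
    { (Algebra.adjoin F (Set.range a)).toRing with mul_comm := hcomm.is_comm.comm }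
  refine ⟨(Algebra.adjoin F (Set.range a)).val.comp
    (aeval fun i => ⟨a i, Algebra.subset_adjoin ⟨i, rfl⟩⟩), fun i => ?_⟩
  simp

/-- Existence of the normal ordering map, characterised by its behaviour on generators. -/
theorem exists_normalOrder (F : Type*) [CommRing F] (n : ℕ) :
    ∃ N : MvPolynomial (Fin n ⊕ Fin n) F →ₗ[F] WeylAlgebra F n, N 1 = 1 ∧
      (∀ i f, N (f * MvPolynomial.X (Sum.inl i)) = X i * N f) ∧
      (∀ i f, N (f * MvPolynomial.X (Sum.inr i)) = N f * Y i) := by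
  obtain ⟨gx, hx⟩ := exists_algHom_X (F := F) (X : Fin n → WeylAlgebra F n) X_mul_X
  obtain ⟨gy, hy⟩ := exists_algHom_X (F := F) (Y : Fin n → WeylAlgebra F n) Y_mul_Y
  let e := Finsupp.sumFinsuppAddEquivProdFinsupp (M := ℕ) (α := Fin n) (β := Fin n)
  let N : MvPolynomial (Fin n ⊕ Fin n) F →ₗ[F] WeylAlgebra F n :=
    (basisMonomials (Fin n ⊕ Fin n) F).constr F
      fun γ => gx (monomial (e γ).1 1) * gy (monomial (e γ).2 1)
  have hN (γ) : N (monomial γ 1) = gx (monomial (e γ).1 1) * gy (monomial (e γ).2 1) := by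
    have := (basisMonomials (Fin n ⊕ Fin n) F).constr_basis F
      (fun γ => gx (monomial (e γ).1 1) * gy (monomial (e γ).2 1)) γ
    rwa [coe_basisMonomials] at this
  have el (i : Fin n) : e (Finsupp.single (Sum.inl i) 1) = (Finsupp.single i 1, 0) := by
    refine Prod.ext (Finsupp.ext fun j => ?_) (Finsupp.ext fun j => ?_) <;>
      simp [e, Finsupp.single_apply]
  have er (i : Fin n) : e (Finsupp.single (Sum.inr i) 1) = (0, Finsupp.single i 1) := by
    refine Prod.ext (Finsupp.ext fun j => ?_) (Finsupp.ext fun j => ?_) <;>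
      simp [e, Finsupp.single_apply]
  refine ⟨N, ?_, fun i f => ?_, fun i f => ?_⟩
  · have := hN 0
    simpa using this
  · suffices N ∘ₗ LinearMap.mulRight F (MvPolynomial.X (Sum.inl i)) =
        LinearMap.mulLeft F (X i) ∘ₗ N from LinearMap.congr_fun this f
    refine (basisMonomials _ F).ext fun γ => ?_
    simp only [coe_basisMonomials, LinearMap.comp_apply, LinearMap.mulRight_apply,
      LinearMap.mulLeft_apply]
    rw [MvPolynomial.X, monomial_mul, mul_one, hN, hN, map_add, el, ← mul_assoc, ← hx, ← map_mul,
      mul_comm, MvPolynomial.X, monomial_mul]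
    simp
  · suffices N ∘ₗ LinearMap.mulRight F (MvPolynomial.X (Sum.inr i)) =
        LinearMap.mulRight F (Y i) ∘ₗ N from LinearMap.congr_fun this f
    refine (basisMonomials _ F).ext fun γ => ?_
    simp only [coe_basisMonomials, LinearMap.comp_apply, LinearMap.mulRight_apply]
    rw [MvPolynomial.X, monomial_mul, mul_one, hN, hN, map_add, er, mul_assoc, ← hy, ← map_mul,
      MvPolynomial.X, monomial_mul]
    simp

/-- The normal ordering map, sending a commutative monomial `x^α y^β` to `x^α y^β`. -/
noncomputable def normalOrder (F : Type*) [CommRing F] (n : ℕ) :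
    MvPolynomial (Fin n ⊕ Fin n) F →ₗ[F] WeylAlgebra F n :=
  (exists_normalOrder F n).choose

theorem normalOrder_one : normalOrder F n 1 = 1 :=
  (exists_normalOrder F n).choose_spec.1

theorem normalOrder_C (r : F) : normalOrder F n (C r) = algebraMap F _ r := by
  rw [← mul_one (C r), ← smul_eq_C_mul, map_smul, normalOrder_one, Algebra.algebraMap_eq_smul_one]

theorem normalOrder_C_mul (r : F) (f : MvPolynomial (Fin n ⊕ Fin n) F) :
    normalOrder F n (C r * f) = algebraMap F _ r * normalOrder F n f := by
  rw [← smul_eq_C_mul, map_smul, Algebra.smul_def]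

theorem normalOrder_mul_X_inl (i : Fin n) (f : MvPolynomial (Fin n ⊕ Fin n) F) :
    normalOrder F n (f * MvPolynomial.X (Sum.inl i)) = X i * normalOrder F n f :=
  (exists_normalOrder F n).choose_spec.2.1 i f

theorem normalOrder_mul_X_inr (i : Fin n) (f : MvPolynomial (Fin n ⊕ Fin n) F) :
    normalOrder F n (f * MvPolynomial.X (Sum.inr i)) = normalOrder F n f * Y i :=
  (exists_normalOrder F n).choose_spec.2.2 i f

theorem normalOrder_pderiv_inl (i : Fin n) (f : MvPolynomial (Fin n ⊕ Fin n) F) :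
    normalOrder F n (pderiv (Sum.inl i) f) = Y i * normalOrder F n f - normalOrder F n f * Y i := by
  induction f using MvPolynomial.induction_on with
  | C r => simp [normalOrder_C, Algebra.commutes]
  | add f g hf hg => simp only [map_add, hf, hg, mul_add, add_mul]; abel
  | mul_X f j hf =>
    cases j with
    | inl j =>
      have h : normalOrder F n (f * Pi.single (M := fun _ => MvPolynomial (Fin n ⊕ Fin n) F)
          (Sum.inl i : Fin n ⊕ Fin n) 1 (Sum.inl j)) = (if i = j then 1 else 0) * normalOrder F n f := by
        by_cases h : i = j
        · subst h; simp
        · simp [h, Ne.symm h]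
      rw [pderiv_mul, pderiv_X, map_add, normalOrder_mul_X_inl, normalOrder_mul_X_inl, hf, h,
        ← mul_assoc (Y i), Y_mul_X]
      noncomm_ring
    | inr j =>
      rw [pderiv_mul, pderiv_X, map_add, normalOrder_mul_X_inr, normalOrder_mul_X_inr, hf]
      simp [sub_mul, mul_assoc, Y_mul_Y i j]

theorem normalOrder_pderiv_inr (i : Fin n) (f : MvPolynomial (Fin n ⊕ Fin n) F) :
    normalOrder F n (pderiv (Sum.inr i) f) = normalOrder F n f * X i - X i * normalOrder F n f := by
  induction f using MvPolynomial.induction_on with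
  | C r => simp [normalOrder_C, Algebra.commutes]
  | add f g hf hg => simp only [map_add, hf, hg, mul_add, add_mul]; abel
  | mul_X f j hf =>
    cases j with
    | inr j =>
      have h : normalOrder F n (f * Pi.single (M := fun _ => MvPolynomial (Fin n ⊕ Fin n) F)
          (Sum.inr i : Fin n ⊕ Fin n) 1 (Sum.inr j)) = normalOrder F n f * (if j = i then 1 else 0) := by
        by_cases h : j = i
        · subst h; simp
        · simp [h]
      rw [pderiv_mul, pderiv_X, map_add, normalOrder_mul_X_inr, normalOrder_mul_X_inr, hf, h,
        mul_assoc _ (Y j), Y_mul_X]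
      noncomm_ring
    | inl j =>
      rw [pderiv_mul, pderiv_X, map_add, normalOrder_mul_X_inl, normalOrder_mul_X_inl, hf]
      simp [mul_sub, ← mul_assoc, X_mul_X i j]

theorem normalOrder_action (a : WeylAlgebra F n) :
    ∀ f, normalOrder F n (action F n a f) = a * normalOrder F n f := by
  induction a using induction with
  | algebraMap r => intro f; simp [smul_eq_C_mul, normalOrder_C_mul]
  | X i => intro f; rw [action_X, mul_comm, normalOrder_mul_X_inl]
  | Y i =>
    intro f
    rw [action_Y, mul_comm, map_add, normalOrder_mul_X_inr, normalOrder_pderiv_inl]; abel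
  | mul a b ha hb => intro f; simp [ha, hb, mul_assoc]
  | add a b ha hb => intro f; simp [ha, hb, add_mul]

theorem action_normalOrder (f : MvPolynomial (Fin n ⊕ Fin n) F) :
    action F n (normalOrder F n f) 1 = f := by
  induction f using MvPolynomial.induction_on with
  | C r => rw [normalOrder_C, AlgHom.commutes, Module.algebraMap_end_apply, smul_eq_C_mul, mul_one]
  | add f g hf hg => rw [map_add, map_add, LinearMap.add_apply, hf, hg]
  | mul_X f j hf =>
    cases j with
    | inl j => rw [normalOrder_mul_X_inl, map_mul, Module.End.mul_apply, hf, action_X, mul_comm]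
    | inr j =>
      rw [normalOrder_mul_X_inr, map_mul, Module.End.mul_apply, action_Y, mul_one, pderiv_one,
        add_zero, ← one_mul (MvPolynomial.X _), action_mul_X_inr, hf, one_mul]

theorem normalOrder_injective : Function.Injective (normalOrder F n) :=
  Function.LeftInverse.injective (g := fun a => action F n a 1) action_normalOrder

theorem normalOrder_surjective : Function.Surjective (normalOrder F n) := fun a =>
  ⟨action F n a 1, by rw [normalOrder_action, normalOrder_one, mul_one]⟩

theorem mem_center_of_commute {a : WeylAlgebra F n} (hX : ∀ i, X i * a = a * X i)
    (hY : ∀ i, Y i * a = a * Y i) : a ∈ Subring.center (WeylAlgebra F n) := by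
  refine Subring.mem_center_iff.2 fun b => ?_
  induction b using induction with
  | algebraMap r => exact Algebra.commutes r a
  | X i => exact hX i
  | Y i => exact hY i
  | mul b c hb hc => rw [mul_assoc, hc, ← mul_assoc, hb, mul_assoc]
  | add b c hb hc => rw [add_mul, mul_add, hb, hc]

theorem pderiv_expand {σ : Type*} {q : ℕ} (hq : (q : F) = 0) (i : σ) (f : MvPolynomial σ F) :
    pderiv i (expand q f) = 0 := by
  induction f using MvPolynomial.induction_on with
  | C r => simp
  | add f g hf hg => simp [hf, hg]
  | mul_X f j hf =>
    have : (q : MvPolynomial σ F) = 0 := by rw [← map_natCast C, hq, map_zero]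
    rw [map_mul, expand_X, pderiv_mul, hf, pderiv_pow, this]
    simp

theorem normalOrder_expand_mem_center {q : ℕ} (hq : (q : F) = 0)
    (f : MvPolynomial (Fin n ⊕ Fin n) F) :
    normalOrder F n (expand q f) ∈ Subring.center (WeylAlgebra F n) := by
  refine mem_center_of_commute (fun i => ?_) fun i => ?_
  · have := normalOrder_pderiv_inr i (expand q f)
    rw [pderiv_expand hq, map_zero] at this
    exact (sub_eq_zero.1 this.symm).symm
  · have := normalOrder_pderiv_inl i (expand q f)
    rw [pderiv_expand hq, map_zero] at this
    exact sub_eq_zero.1 this.symm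

theorem normalOrder_mul_X_inl_pow (i : Fin n) (f : MvPolynomial (Fin n ⊕ Fin n) F) (q : ℕ) :
    normalOrder F n (f * MvPolynomial.X (Sum.inl i) ^ q) = X i ^ q * normalOrder F n f := by
  induction q with
  | zero => simp
  | succ q ih => rw [pow_succ, ← mul_assoc, normalOrder_mul_X_inl, ih, pow_succ', mul_assoc]

theorem normalOrder_mul_X_inr_pow (i : Fin n) (f : MvPolynomial (Fin n ⊕ Fin n) F) (q : ℕ) :
    normalOrder F n (f * MvPolynomial.X (Sum.inr i) ^ q) = normalOrder F n f * Y i ^ q := by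
  induction q with
  | zero => simp
  | succ q ih => rw [pow_succ, ← mul_assoc, normalOrder_mul_X_inr, ih, pow_succ, mul_assoc]

theorem Y_pow_mem_center {q : ℕ} (hq : (q : F) = 0) (i : Fin n) :
    (Y i ^ q : WeylAlgebra F n) ∈ Subring.center (WeylAlgebra F n) := by
  have := normalOrder_expand_mem_center hq (MvPolynomial.X (Sum.inr i) : MvPolynomial _ F)
  rwa [expand_X, ← one_mul (MvPolynomial.X _ ^ _), normalOrder_mul_X_inr_pow, normalOrder_one,
    one_mul] at this

theorem X_pow_mem_center {q : ℕ} (hq : (q : F) = 0) (i : Fin n) :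
    (X i ^ q : WeylAlgebra F n) ∈ Subring.center (WeylAlgebra F n) := by
  have := normalOrder_expand_mem_center hq (MvPolynomial.X (Sum.inl i) : MvPolynomial _ F)
  rwa [expand_X, ← one_mul (MvPolynomial.X _ ^ _), normalOrder_mul_X_inl_pow, normalOrder_one,
    mul_one] at this

theorem normalOrder_expand_mul {q : ℕ} (hq : (q : F) = 0) (c : MvPolynomial (Fin n ⊕ Fin n) F) :
    ∀ f, normalOrder F n (expand q c * f) = normalOrder F n (expand q c) * normalOrder F n f := by
  induction c using MvPolynomial.induction_on with
  | C r => intro f; rw [expand_C, normalOrder_C_mul, normalOrder_C]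
  | add c d hc hd => intro f; rw [map_add, add_mul, map_add, hc, hd, map_add, add_mul]
  | mul_X c j hc =>
    intro f
    rw [map_mul (expand q), expand_X, mul_assoc, mul_comm (MvPolynomial.X j ^ q), hc]
    cases j with
    | inl j =>
      rw [normalOrder_mul_X_inl_pow, normalOrder_mul_X_inl_pow, ← mul_assoc,
        Subring.mem_center_iff.1 (X_pow_mem_center hq j)]
    | inr j =>
      rw [normalOrder_mul_X_inr_pow, normalOrder_mul_X_inr_pow, mul_assoc,
        Subring.mem_center_iff.1 (Y_pow_mem_center hq j)]

/-- The ring map `F[x, y] → F[x^q, y^q] ⊆ A_n(F)`, central when `q = 0` in `F`. -/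
noncomputable def powHom (F : Type*) [CommRing F] (n : ℕ) {q : ℕ} (hq : (q : F) = 0) :
    MvPolynomial (Fin n ⊕ Fin n) F →+* WeylAlgebra F n where
  toFun c := normalOrder F n (expand q c)
  map_one' := by rw [map_one, normalOrder_one]
  map_zero' := by rw [map_zero, map_zero]
  map_add' c d := by rw [map_add, map_add]
  map_mul' c d := by rw [map_mul, normalOrder_expand_mul hq]

theorem powHom_apply {q : ℕ} (hq : (q : F) = 0) (c : MvPolynomial (Fin n ⊕ Fin n) F) :
    powHom F n hq c = normalOrder F n (expand q c) := rfl

theorem powHom_commute {q : ℕ} (hq : (q : F) = 0) (c : MvPolynomial (Fin n ⊕ Fin n) F)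
    (a : WeylAlgebra F n) : powHom F n hq c * a = a * powHom F n hq c :=
  (Subring.mem_center_iff.1 (normalOrder_expand_mem_center hq c) a).symm

theorem isIntegral_expand {σ : Type*} {q : ℕ} (hq0 : 0 < q) :
    (expand q : MvPolynomial σ F →ₐ[F] MvPolynomial σ F).toRingHom.IsIntegral := by
  intro f
  induction f using MvPolynomial.induction_on with
  | C r =>
    have := RingHom.isIntegralElem_map
      (f := (expand q : MvPolynomial σ F →ₐ[F] MvPolynomial σ F).toRingHom) (x := C r)
    simpa using this
  | add f g hf hg => exact hf.add _ hg
  | mul_X f j hf =>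
    refine hf.mul _ ⟨Polynomial.X ^ q - Polynomial.C (MvPolynomial.X j),
      Polynomial.monic_X_pow_sub_C _ hq0.ne', by simp⟩

theorem isIntegral_of_semilinear_surjective {R B A : Type*} [CommRing R] [CommRing B] [Ring A]
    [Algebra R A] {f : R →+* B} (hf : f.Finite) (N : B →+ A)
    (hN : ∀ c b, N (f c * b) = algebraMap R A c * N b) (hs : Function.Surjective N) :
    Algebra.IsIntegral R A := by
  algebraize [f]
  let N' : B →ₗ[R] A :=
    { toFun := N, map_add' := map_add N, map_smul' := fun c b => by
        simp only [Algebra.smul_def, RingHom.id_apply]; exact hN c b }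
  have : Module.Finite R A := Module.Finite.of_surjective N' hs
  infer_instance

theorem finite_expand {σ : Type*} [Finite σ] {q : ℕ} (hq0 : 0 < q) :
    (expand q : MvPolynomial σ F →ₐ[F] MvPolynomial σ F).toRingHom.Finite := by
  refine (isIntegral_expand hq0).to_finite (RingHom.FiniteType.of_comp_finiteType (f := C) ?_)
  have : (expand q : MvPolynomial σ F →ₐ[F] MvPolynomial σ F).toRingHom.comp C = C :=
    RingHom.ext fun r => by simp
  rw [this, ← MvPolynomial.algebraMap_eq, RingHom.finiteType_algebraMap]
  infer_instance

/-- The algebra structure on the Weyl algebra over the polynomials in the central `q`-th powers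
of the generators. -/
@[reducible] noncomputable def powAlgebra (F : Type*) [CommRing F] (n : ℕ) {q : ℕ}
    (hq : (q : F) = 0) : Algebra (MvPolynomial (Fin n ⊕ Fin n) F) (WeylAlgebra F n) :=
  (powHom F n hq).toAlgebra' (powHom_commute hq)

theorem exists_monic_aeval {q : ℕ} (hq : (q : F) = 0) (hq0 : 0 < q) (s : WeylAlgebra F n) :
    letI := powAlgebra F n hq
    ∃ P : Polynomial (MvPolynomial (Fin n ⊕ Fin n) F), P.Monic ∧ Polynomial.aeval s P = 0 := by
  let _ := powAlgebra F n hq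
  exact (isIntegral_of_semilinear_surjective (finite_expand hq0) (normalOrder F n).toAddMonoidHom
    (normalOrder_expand_mul hq) normalOrder_surjective).isIntegral s

end WeylAlgebra

/-- A ring which behaves like `W(k)/(p^m)`: the ideal `(p)` is prime, `p^m = 0`, and it is flat
over `ℤ/p^m`. -/
structure IsTruncated (p m : ℕ) (F : Type*) [CommRing F] : Prop where
  pos : 0 < m
  pow_eq_zero : (p : F) ^ m = 0
  not_dvd_one : ¬ (p : F) ∣ 1
  dvd_or_dvd : ∀ a b : F, (p : F) ∣ a * b → (p : F) ∣ a ∨ (p : F) ∣ b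
  pow_dvd_of_mul_eq_zero : ∀ j ≤ m, ∀ a : F, (p : F) ^ j * a = 0 → (p : F) ^ (m - j) ∣ a

namespace IsTruncated

variable {p m : ℕ} {F : Type*} [CommRing F]

theorem natCast_pow_eq_zero (h : IsTruncated p m F) : ((p ^ m : ℕ) : F) = 0 := by
  rw [Nat.cast_pow, h.pow_eq_zero]

theorem natCast_pow_eq_zero_of_le (h : IsTruncated p m F) {k : ℕ} (hk : m ≤ k) :
    ((p ^ k : ℕ) : F) = 0 := by
  rw [Nat.cast_pow, ← Nat.sub_add_cancel hk, pow_add, h.pow_eq_zero, mul_zero]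

theorem not_dvd_pow (h : IsTruncated p m F) {a : F} (ha : ¬ (p : F) ∣ a) (k : ℕ) :
    ¬ (p : F) ∣ a ^ k := by
  induction k with
  | zero => rw [pow_zero]; exact h.not_dvd_one
  | succ k ih => rw [pow_succ]; exact fun hd => (h.dvd_or_dvd _ _ hd).elim ih ha

theorem pow_dvd_of_mul_eq_zero_of_not_dvd (h : IsTruncated p m F) {a b : F}
    (ha : ¬ (p : F) ∣ a) (hab : a * b = 0) (j : ℕ) (hj : j ≤ m) : (p : F) ^ j ∣ b := by
  induction j with
  | zero => simp
  | succ j ih =>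
    obtain ⟨c, rfl⟩ := ih (by lia)
    have h1 : (p : F) ^ j * (a * c) = 0 := by rw [← hab]; ring
    have h2 := (dvd_pow_self (p : F) (by lia : m - j ≠ 0)).trans
      (h.pow_dvd_of_mul_eq_zero j (by lia) _ h1)
    obtain ⟨d, rfl⟩ := (h.dvd_or_dvd _ _ h2).resolve_left ha
    exact ⟨d, by ring⟩

theorem eq_zero_of_mul_eq_zero (h : IsTruncated p m F) {a b : F}
    (ha : ¬ (p : F) ∣ a) (hab : a * b = 0) : b = 0 := by
  obtain ⟨c, rfl⟩ := h.pow_dvd_of_mul_eq_zero_of_not_dvd ha hab m le_rfl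
  rw [h.pow_eq_zero, zero_mul]

theorem natCast_dvd_iff {σ : Type*} {f : MvPolynomial σ F} {k : ℕ} :
    (k : MvPolynomial σ F) ∣ f ↔ ∀ γ, (k : F) ∣ f.coeff γ := by
  rw [← map_natCast (MvPolynomial.C (σ := σ) (R := F)), MvPolynomial.C_dvd_iff_dvd_coeff]

theorem mvPolynomial (h : IsTruncated p m F) (σ : Type*) : IsTruncated p m (MvPolynomial σ F) where
  pos := h.pos
  pow_eq_zero := by
    rw [← map_natCast (MvPolynomial.C (σ := σ) (R := F)), ← map_pow, h.pow_eq_zero, map_zero]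
  not_dvd_one hd := h.not_dvd_one (by simpa using natCast_dvd_iff.1 hd 0)
  dvd_or_dvd f g hfg := by
    have hp : (Ideal.span {(p : F)}).IsPrime :=
      { ne_top' := by
          rw [Ne, Ideal.span_singleton_eq_top, isUnit_iff_dvd_one]; exact h.not_dvd_one
        mem_or_mem' := fun {a b} hab => by
          simp only [Ideal.mem_span_singleton] at hab ⊢
          exact h.dvd_or_dvd a b hab }
    have key (f : MvPolynomial σ F) : (p : MvPolynomial σ F) ∣ f ↔
        MvPolynomial.map (Ideal.Quotient.mk (Ideal.span {(p : F)})) f = 0 := by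
      rw [natCast_dvd_iff, MvPolynomial.ext_iff]
      simp only [MvPolynomial.coeff_map, MvPolynomial.coeff_zero,
        Ideal.Quotient.eq_zero_iff_mem, Ideal.mem_span_singleton]
    rw [key, map_mul, mul_eq_zero] at hfg
    rwa [key, key]
  pow_dvd_of_mul_eq_zero j hj f hf := by
    rw [← Nat.cast_pow, natCast_dvd_iff]
    intro γ
    rw [Nat.cast_pow]
    refine h.pow_dvd_of_mul_eq_zero j hj _ ?_
    rw [← map_natCast (MvPolynomial.C (σ := σ) (R := F)), ← map_pow] at hf
    rw [← MvPolynomial.coeff_C_mul, hf, MvPolynomial.coeff_zero]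

theorem not_dvd_expand {σ : Type*} {q : ℕ} (hq0 : 0 < q) {c : MvPolynomial σ F}
    (hc : ¬ (p : MvPolynomial σ F) ∣ c) :
    ¬ (p : MvPolynomial σ F) ∣ MvPolynomial.expand q c := by
  rw [natCast_dvd_iff] at hc ⊢
  exact fun h => hc fun γ => by
    rw [← MvPolynomial.coeff_expand_smul q hq0.ne']; exact h _

/-- If an integer multiple of an element not divisible by `p` vanishes, the integer is divisible
by `p ^ m`. -/
theorem pow_dvd_nat (h : IsTruncated p m F) (hp : p.Prime) {k : ℕ} {a : F}
    (ha : ¬ (p : F) ∣ a) (hk : (k : F) * a = 0) : p ^ m ∣ k := by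
  have key (u : ℕ) (hu : (p : F) ∣ u) : p ∣ u := by
    by_contra hpu
    have hc : Nat.Coprime p u := (Nat.Prime.coprime_iff_not_dvd hp).2 hpu
    have h1 : (p : F) * ((p.gcdA u : ℤ) : F) + u * ((p.gcdB u : ℤ) : F) = 1 := by
      have := Nat.gcd_eq_gcd_ab p u
      rw [hc] at this
      exact_mod_cast (congrArg (Int.cast : ℤ → F) this).symm
    exact h.not_dvd_one (h1 ▸ dvd_add (dvd_mul_right _ _) (hu.mul_right _))
  have main (j : ℕ) (hj : j ≤ m) : p ^ j ∣ k := by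
    induction j with
    | zero => simp
    | succ j ih =>
      obtain ⟨u, rfl⟩ := ih (by lia)
      have h1 : (p : F) ^ j * (u * a) = 0 := by rw [← hk]; push_cast; ring
      have h2 := (dvd_pow_self (p : F) (by lia : m - j ≠ 0)).trans
        (h.pow_dvd_of_mul_eq_zero j (by lia) _ h1)
      obtain ⟨v, rfl⟩ := key u ((h.dvd_or_dvd _ _ h2).resolve_right ha)
      exact ⟨v, by ring⟩
  exact main m le_rfl

end IsTruncated

namespace WeylAlgebra

open MvPolynomial

variable {F : Type*} [CommRing F] {n p m q : ℕ}

theorem normalOrder_natCast_mul (k : ℕ) (f : MvPolynomial (Fin n ⊕ Fin n) F) :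
    normalOrder F n (k * f) = k * normalOrder F n f := by
  rw [← nsmul_eq_mul, map_nsmul, nsmul_eq_mul]

theorem pow_dvd_of_mul_eq_zero (h : IsTruncated p m F) {j : ℕ} (hj : j ≤ m)
    {a : WeylAlgebra F n} (ha : (p : WeylAlgebra F n) ^ j * a = 0) :
    (p : WeylAlgebra F n) ^ (m - j) ∣ a := by
  obtain ⟨f, rfl⟩ := normalOrder_surjective a
  rw [← Nat.cast_pow, ← normalOrder_natCast_mul, ← map_zero (normalOrder F n)] at ha
  have := normalOrder_injective ha
  rw [Nat.cast_pow] at this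
  obtain ⟨g, rfl⟩ := (h.mvPolynomial _).pow_dvd_of_mul_eq_zero j hj f this
  exact ⟨normalOrder F n g, by rw [← Nat.cast_pow, normalOrder_natCast_mul, Nat.cast_pow]⟩

theorem natCast_pow_eq_zero (h : IsTruncated p m F) : (p : WeylAlgebra F n) ^ m = 0 := by
  rw [← map_natCast (algebraMap F (WeylAlgebra F n)), ← map_pow, h.pow_eq_zero, map_zero]

theorem powHom_mem_nonZeroDivisors (h : IsTruncated p m F) (hq : (q : F) = 0) (hq0 : 0 < q)
    {c : MvPolynomial (Fin n ⊕ Fin n) F} (hc : ¬ (p : MvPolynomial (Fin n ⊕ Fin n) F) ∣ c) :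
    powHom F n hq c ∈ nonZeroDivisors (WeylAlgebra F n) := by
  have key (a : WeylAlgebra F n) (ha : powHom F n hq c * a = 0) : a = 0 := by
    obtain ⟨f, rfl⟩ := normalOrder_surjective a
    rw [powHom_apply, ← normalOrder_expand_mul hq, ← map_zero (normalOrder F n)] at ha
    rw [(h.mvPolynomial _).eq_zero_of_mul_eq_zero (IsTruncated.not_dvd_expand hq0 hc)
      (normalOrder_injective ha), map_zero]
  exact ⟨key, fun a ha => key a (by rw [powHom_commute, ha])⟩

/-- Every non-zero-divisor divides a central polynomial which is nonzero modulo `p`. -/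
theorem exists_mul_eq_powHom (h : IsTruncated p m F) (hq : (q : F) = 0) (hq0 : 0 < q)
    {s : WeylAlgebra F n} (hs : s ∈ nonZeroDivisors (WeylAlgebra F n)) :
    ∃ t c, ¬ (p : MvPolynomial (Fin n ⊕ Fin n) F) ∣ c ∧ t * s = powHom F n hq c := by
  let _ := powAlgebra F n hq
  have halg (c) : algebraMap (MvPolynomial (Fin n ⊕ Fin n) F) (WeylAlgebra F n) c =
    powHom F n hq c := rfl
  have hR := h.mvPolynomial (Fin n ⊕ Fin n)
  suffices H : ∀ (d : ℕ) (P : Polynomial (MvPolynomial (Fin n ⊕ Fin n) F)), P.natDegree < d →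
      ¬ Polynomial.C (p : MvPolynomial (Fin n ⊕ Fin n) F) ∣ P →
      (p : WeylAlgebra F n) ∣ Polynomial.aeval s P →
      ∃ t c, ¬ (p : MvPolynomial (Fin n ⊕ Fin n) F) ∣ c ∧ t * s = powHom F n hq c by
    obtain ⟨P, hP, hPs⟩ := exists_monic_aeval hq hq0 s
    refine H _ P (Nat.lt_succ_self _) (fun hd => hR.not_dvd_one ?_) (hPs ▸ dvd_zero _)
    have := (Polynomial.C_dvd_iff_dvd_coeff _ _).1 hd P.natDegree
    rwa [hP.coeff_natDegree] at this
  intro d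
  induction d with
  | zero => intro P hP; exact absurd hP (Nat.not_lt_zero _)
  | succ d ih =>
    intro P hP hPp ⟨w, hw⟩
    set v := Polynomial.aeval s P.divX with hv
    set c := P.coeff 0 with hc
    have hPs : v * s + powHom F n hq c = p * w := by
      rw [← hw]
      conv_rhs => rw [← P.divX_mul_X_add]
      rw [map_add, map_mul, Polynomial.aeval_X, Polynomial.aeval_C, halg]
    by_cases hpc : (p : MvPolynomial (Fin n ⊕ Fin n) F) ∣ c
    · obtain ⟨c', hc'⟩ := hpc
      have hdivX : ¬ Polynomial.C (p : MvPolynomial (Fin n ⊕ Fin n) F) ∣ P.divX := by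
        refine fun hd => hPp ?_
        rw [← P.divX_mul_X_add]
        refine dvd_add (hd.mul_right _) ?_
        rw [← hc, hc', map_mul]
        exact dvd_mul_right _ _
      have hdeg : P.natDegree ≠ 0 := fun h0 => hdivX <| by
        rw [Polynomial.eq_C_of_natDegree_eq_zero h0, Polynomial.divX_C]
        exact dvd_zero _
      refine ih P.divX ?_ hdivX ?_
      · rw [Polynomial.natDegree_divX_eq_natDegree_tsub_one]; lia
      · have h1 : v * s = p * (w - powHom F n hq c') := by
          rw [mul_sub, ← hPs, hc', map_mul, map_natCast]; abel
        have h2 : (p : WeylAlgebra F n) ^ (m - 1) * v * s = 0 := by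
          rw [mul_assoc, h1, ← mul_assoc, ← pow_succ, Nat.sub_add_cancel h.pos,
            natCast_pow_eq_zero h, zero_mul]
        have h3 := pow_dvd_of_mul_eq_zero h (Nat.sub_le m 1) (hs.2 _ h2)
        rwa [Nat.sub_sub_self h.pos, pow_one] at h3
    · have hcomm : Commute (powHom F n hq c) ((p : WeylAlgebra F n) * w) := powHom_commute hq c _
      refine ⟨-((∑ i ∈ Finset.range m, powHom F n hq c ^ i * ((p : WeylAlgebra F n) * w) ^
        (m - 1 - i)) * v), c ^ m, hR.not_dvd_pow hpc m, ?_⟩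
      have h0 : ((p : WeylAlgebra F n) * w) ^ m = 0 := by
        rw [(Nat.cast_commute p w).mul_pow, natCast_pow_eq_zero h, zero_mul]
      have := hcomm.geom_sum₂_mul m
      rw [h0, sub_zero, ← map_pow] at this
      rw [← this, ← hPs]
      noncomm_ring

theorem exists_eq_expand_add {σ : Type*} {q : ℕ} {f : MvPolynomial σ F}
    (hf : ∀ γ, (p : F) ∣ f.coeff γ ∨ ∀ i, q ∣ γ i) :
    ∃ f₀ g : MvPolynomial σ F, f = expand q f₀ + p * g := by
  let S : AddSubgroup (MvPolynomial σ F) :=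
    (expand q : MvPolynomial σ F →ₐ[F] MvPolynomial σ F).toRingHom.toAddMonoidHom.range ⊔
      (AddMonoidHom.mulLeft (p : MvPolynomial σ F)).range
  have hS : f ∈ S := by
    rw [← f.support_sum_monomial_coeff]
    refine sum_mem fun γ _ => ?_
    obtain ⟨r, hr⟩ | hγ := hf γ
    · exact AddSubgroup.mem_sup_right ⟨monomial γ r, by
        rw [hr, ← map_natCast (C (σ := σ) (R := F)), AddMonoidHom.coe_mulLeft, C_mul_monomial]⟩
    · refine AddSubgroup.mem_sup_left ⟨monomial (γ.mapRange (· / q) (Nat.zero_div q))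
        (f.coeff γ), ?_⟩
      have : q • γ.mapRange (· / q) (Nat.zero_div q) = γ :=
        Finsupp.ext fun i => Nat.mul_div_cancel' (hγ i)
      exact (expand_monomial q _ _).trans (by rw [this])
  obtain ⟨_, ⟨f₀, rfl⟩, _, ⟨g, rfl⟩, hfg⟩ := AddSubgroup.mem_sup.1 hS
  exact ⟨f₀, g, hfg.symm⟩

/-- A central element is modulo `p` a polynomial in the `p^m`-th powers of the generators. -/
theorem exists_eq_powHom_add_of_mem_center (h : IsTruncated p m F) (hp : p.Prime)
    {a : WeylAlgebra F n} (ha : a ∈ Subring.center (WeylAlgebra F n)) :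
    ∃ c b, a = powHom F n h.natCast_pow_eq_zero c + p * b := by
  obtain ⟨f, rfl⟩ := normalOrder_surjective a
  have hcomm := Subring.mem_center_iff.1 ha
  have hd (i) : pderiv i f = 0 := by
    refine normalOrder_injective ?_
    cases i with
    | inl i => rw [normalOrder_pderiv_inl, hcomm, sub_self, map_zero]
    | inr i => rw [normalOrder_pderiv_inr, hcomm, sub_self, map_zero]
  have hf : ∀ γ, (p : F) ∣ f.coeff γ ∨ ∀ i, p ^ m ∣ γ i := by
    intro γ
    by_contra! hγ
    obtain ⟨h1, i, h2⟩ := hγ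
    refine h2 (h.pow_dvd_nat hp h1 ?_)
    have h0 : γ i ≠ 0 := fun h0 => h2 (h0 ▸ dvd_zero _)
    have := congrArg (coeff (γ - Finsupp.single i 1)) (hd i)
    rw [coeff_pderiv, Finsupp.sub_add_single_one_cancel h0, coeff_zero, mul_comm] at this
    rw [← this, Finsupp.tsub_apply, Finsupp.single_eq_same, ← Nat.cast_succ, Nat.succ_eq_add_one,
      Nat.sub_add_cancel (Nat.one_le_iff_ne_zero.2 h0)]
  obtain ⟨f₀, g, rfl⟩ := exists_eq_expand_add hf
  exact ⟨f₀, normalOrder F n g, by rw [map_add, normalOrder_natCast_mul, powHom_apply]⟩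

end WeylAlgebra

section divClosure

variable {D : Type*} [Ring D] {S : Set D}

theorem subset_divClosure : S ⊆ divClosure S :=
  fun _ hx => Subring.mem_sInf.2 fun _ hT => hT.1 hx

theorem divClosure_le {T : Subring D} (hS : S ⊆ T)
    (hT : ∀ x ∈ T, ∀ y : D, x * y = 1 → y * x = 1 → y ∈ T) : divClosure S ≤ T :=
  sInf_le ⟨hS, hT⟩

theorem inv_mem_divClosure {x y : D} (hx : x ∈ divClosure S) (hxy : x * y = 1) (hyx : y * x = 1) :
    y ∈ divClosure S :=
  Subring.mem_sInf.2 fun T hT => hT.2 x (Subring.mem_sInf.1 hx T hT) y hxy hyx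

theorem inv_mem_center {x y : D} (hx : x ∈ Subring.center D) (hxy : x * y = 1) (hyx : y * x = 1) :
    y ∈ Subring.center D := by
  let u : Dˣ := ⟨x, y, hxy, hyx⟩
  refine Subring.mem_center_iff.2 fun d => ?_
  have : Commute d (u : D) := Subring.mem_center_iff.1 hx d
  exact this.units_inv_right

end divClosure

namespace WeylLoc

open MvPolynomial WeylAlgebra

variable {F : Type*} [CommRing F] {n p m q : ℕ}
  [OreLocalization.OreSet (nonZeroDivisors (WeylAlgebra F n))]

/-- The canonical map from the Weyl algebra to its localization. -/
noncomputable def of (F : Type*) [CommRing F] (n : ℕ)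
    [OreLocalization.OreSet (nonZeroDivisors (WeylAlgebra F n))] :
    WeylAlgebra F n →+* WeylLoc F n :=
  OreLocalization.numeratorRingHom

theorem of_X (i : Fin n) : of F n (X i) = locX F n i := rfl

theorem of_Y (i : Fin n) : of F n (Y i) = locY F n i := rfl

theorem of_algebraMap (r : F) : of F n (algebraMap F _ r) = algebraMap F (WeylLoc F n) r := rfl

theorem of_injective : Function.Injective (of F n) :=
  OreLocalization.numeratorHom_inj fun _ hx => hx.1

theorem isUnit_of {s : WeylAlgebra F n} (hs : s ∈ nonZeroDivisors (WeylAlgebra F n)) :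
    IsUnit (of F n s) :=
  OreLocalization.numerator_isUnit (⟨s, hs⟩ : nonZeroDivisors (WeylAlgebra F n))

theorem exists_of_mul_eq_of (d : WeylLoc F n) :
    ∃ s ∈ nonZeroDivisors (WeylAlgebra F n), ∃ a, of F n s * d = of F n a := by
  induction d using OreLocalization.ind with
  | _ a s =>
    refine ⟨s, s.2, a, ?_⟩
    change (OreLocalization.oreDiv (s : WeylAlgebra F n) 1) * OreLocalization.oreDiv a s =
      OreLocalization.oreDiv a 1
    exact OreLocalization.mul_cancel

theorem exists_of_powHom_mul_eq_of (h : IsTruncated p m F) (hq : (q : F) = 0) (hq0 : 0 < q)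
    (d : WeylLoc F n) :
    ∃ c a, ¬ (p : MvPolynomial (Fin n ⊕ Fin n) F) ∣ c ∧ of F n (powHom F n hq c) * d = of F n a := by
  obtain ⟨s, hs, a, hsa⟩ := exists_of_mul_eq_of d
  obtain ⟨t, c, hc, htc⟩ := exists_mul_eq_powHom h hq hq0 hs
  exact ⟨c, t * a, hc, by rw [← htc, map_mul, mul_assoc, hsa, map_mul]⟩

theorem mem_center_of_commute {d : WeylLoc F n} (hd : ∀ a, of F n a * d = d * of F n a) :
    d ∈ Subring.center (WeylLoc F n) := by
  refine Subring.mem_center_iff.2 fun e => ?_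
  obtain ⟨s, hs, a, hsa⟩ := exists_of_mul_eq_of e
  refine (isUnit_of hs).mul_left_cancel ?_
  rw [← mul_assoc, hsa, ← mul_assoc, hd s, mul_assoc, hsa, hd]

theorem of_mem_center {a : WeylAlgebra F n} (ha : a ∈ Subring.center (WeylAlgebra F n)) :
    of F n a ∈ Subring.center (WeylLoc F n) :=
  mem_center_of_commute fun b => by rw [← map_mul, ← map_mul, Subring.mem_center_iff.1 ha]

theorem of_powHom_mem_center (hq : (q : F) = 0) (c : MvPolynomial (Fin n ⊕ Fin n) F) :
    of F n (powHom F n hq c) ∈ Subring.center (WeylLoc F n) :=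
  of_mem_center (normalOrder_expand_mem_center hq c)

theorem isUnit_of_powHom (h : IsTruncated p m F) (hq : (q : F) = 0) (hq0 : 0 < q)
    {c : MvPolynomial (Fin n ⊕ Fin n) F} (hc : ¬ (p : MvPolynomial (Fin n ⊕ Fin n) F) ∣ c) :
    IsUnit (of F n (powHom F n hq c)) :=
  isUnit_of (powHom_mem_nonZeroDivisors h hq hq0 hc)

theorem natCast_eq_zero {k : ℕ} (hk : (k : F) = 0) : (k : WeylLoc F n) = 0 := by
  rw [← map_natCast (algebraMap F (WeylLoc F n)), hk, map_zero]

theorem natCast_pow_eq_zero (h : IsTruncated p m F) : (p : WeylLoc F n) ^ m = 0 := by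
  rw [← Nat.cast_pow, natCast_eq_zero h.natCast_pow_eq_zero]

theorem dvd_of_of_mul_eq {u : WeylLoc F n} (hu : IsUnit u) {k : ℕ} {d : WeylLoc F n}
    {a : WeylAlgebra F n} (hd : u * d = of F n a) (ha : (k : WeylAlgebra F n) ∣ a) :
    (k : WeylLoc F n) ∣ d := by
  obtain ⟨b, rfl⟩ := ha
  obtain ⟨u, rfl⟩ := hu
  refine ⟨↑u⁻¹ * of F n b, ?_⟩
  rw [← mul_assoc, Nat.cast_comm, mul_assoc, Units.eq_inv_mul_iff_mul_eq, hd, map_mul, map_natCast]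

theorem pow_dvd_of_mul_eq_zero (h : IsTruncated p m F) {j : ℕ} (hj : j ≤ m)
    {d : WeylLoc F n} (hd : (p : WeylLoc F n) ^ j * d = 0) :
    (p : WeylLoc F n) ^ (m - j) ∣ d := by
  obtain ⟨s, hs, a, hsa⟩ := exists_of_mul_eq_of d
  rw [← Nat.cast_pow]
  refine dvd_of_of_mul_eq (isUnit_of hs) hsa ?_
  rw [Nat.cast_pow]
  refine WeylAlgebra.pow_dvd_of_mul_eq_zero h hj (of_injective ?_)
  rw [map_mul, ← hsa, ← mul_assoc, ← Nat.cast_pow, map_natCast, Nat.cast_comm, mul_assoc,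
    Nat.cast_pow, hd, mul_zero, map_zero]

theorem ratSubfield_le_center (hq : (q : F) = 0) :
    ratSubfield F n q ≤ Subring.center (WeylLoc F n) := by
  refine divClosure_le ?_ fun x hx y => inv_mem_center hx
  rintro _ ((⟨r, rfl⟩ | ⟨i, rfl⟩) | ⟨i, rfl⟩)
  · exact Subring.mem_center_iff.2 fun d => (Algebra.commutes r d).symm
  · simp only [← of_X, ← map_pow]; exact of_mem_center (X_pow_mem_center hq i)
  · simp only [← of_Y, ← map_pow]; exact of_mem_center (Y_pow_mem_center hq i)

theorem of_powHom_mem_ratSubfield (hq : (q : F) = 0) (c : MvPolynomial (Fin n ⊕ Fin n) F) :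
    of F n (powHom F n hq c) ∈ ratSubfield F n q := by
  induction c using MvPolynomial.induction_on with
  | C r =>
    rw [powHom_apply, expand_C, normalOrder_C]
    exact subset_divClosure (.inl (.inl ⟨r, rfl⟩))
  | add c d hc hd => rw [map_add, map_add]; exact add_mem hc hd
  | mul_X c i hc =>
    rw [map_mul, map_mul]
    refine mul_mem hc (subset_divClosure ?_)
    rw [powHom_apply, expand_X, ← one_mul (MvPolynomial.X _ ^ _)]
    cases i with
    | inl i =>
      rw [normalOrder_mul_X_inl_pow, normalOrder_one, mul_one, map_pow]
      exact .inl (.inr ⟨i, rfl⟩)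
    | inr i =>
      rw [normalOrder_mul_X_inr_pow, normalOrder_one, one_mul, map_pow]
      exact .inr ⟨i, rfl⟩

/-- A central element is congruent modulo `p` to a rational function in the `p^m`-th powers. -/
theorem exists_eq_add_of_mem_center (h : IsTruncated p m F) (hp : p.Prime) {z : WeylLoc F n}
    (hz : z ∈ Subring.center (WeylLoc F n)) :
    ∃ a ∈ ratSubfield F n (p ^ m), ∃ w, z = a + p * w := by
  obtain ⟨c, a, hc, hca⟩ := exists_of_powHom_mul_eq_of h h.natCast_pow_eq_zero
    (pow_pos hp.pos m) z
  have ha : a ∈ Subring.center (WeylAlgebra F n) := by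
    have := mul_mem (of_powHom_mem_center h.natCast_pow_eq_zero c) hz
    rw [hca] at this
    refine Subring.mem_center_iff.2 fun b => of_injective ?_
    rw [map_mul, map_mul, Subring.mem_center_iff.1 this]
  obtain ⟨f, b, rfl⟩ := exists_eq_powHom_add_of_mem_center h hp ha
  obtain ⟨u, hu⟩ := isUnit_of_powHom h h.natCast_pow_eq_zero (pow_pos hp.pos m) hc
  have hu' : (↑u⁻¹ : WeylLoc F n) ∈ ratSubfield F n (p ^ m) :=
    inv_mem_divClosure (x := (u : WeylLoc F n)) (hu ▸ of_powHom_mem_ratSubfield _ c)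
      u.mul_inv u.inv_mul
  refine ⟨↑u⁻¹ * of F n (powHom F n h.natCast_pow_eq_zero f),
    mul_mem hu' (of_powHom_mem_ratSubfield _ f), ↑u⁻¹ * of F n b, ?_⟩
  rw [← mul_assoc, Nat.cast_comm, mul_assoc, ← mul_add, Units.eq_inv_mul_iff_mul_eq, hu, hca,
    map_add, map_mul, map_natCast]

/-- In characteristic `p` the center is the field of rational functions in the `p`-th powers. -/
theorem center_eq_ratSubfield (h : IsTruncated p 1 F) (hp : p.Prime) :
    Subring.center (WeylLoc F n) = ratSubfield F n p := by
  have hp0 : (p : F) = 0 := by simpa using h.pow_eq_zero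
  refine le_antisymm (fun z hz => ?_) (ratSubfield_le_center hp0)
  obtain ⟨a, ha, w, rfl⟩ := exists_eq_add_of_mem_center h hp hz
  rw [natCast_eq_zero hp0, zero_mul, add_zero]
  rwa [pow_one] at ha

section Reduction

variable {F' : Type*} [CommRing F'] {e : ℕ}
  [OreLocalization.OreSet (nonZeroDivisors (WeylAlgebra F' n))]
  {θ : F →+* F'} {f : WeylLoc F n →+* WeylLoc F' n}

theorem map_of_normalOrder (hX : ∀ i, f (locX F n i) = locX F' n i)
    (hY : ∀ i, f (locY F n i) = locY F' n i)
    (hC : ∀ r, f (algebraMap F _ r) = algebraMap F' _ (θ r))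
    (g : MvPolynomial (Fin n ⊕ Fin n) F) :
    f (of F n (normalOrder F n g)) = of F' n (normalOrder F' n (MvPolynomial.map θ g)) := by
  induction g using MvPolynomial.induction_on with
  | C r => rw [MvPolynomial.map_C, normalOrder_C, normalOrder_C, of_algebraMap, hC, of_algebraMap]
  | add g g' hg hg' => simp only [map_add, hg, hg']
  | mul_X g i hg =>
    rw [map_mul (MvPolynomial.map θ), map_X]
    cases i with
    | inl i => rw [normalOrder_mul_X_inl, normalOrder_mul_X_inl, map_mul, map_mul, map_mul, hg,
        of_X, of_X, hX]
    | inr i => rw [normalOrder_mul_X_inr, normalOrder_mul_X_inr, map_mul, map_mul, map_mul, hg,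
        of_Y, of_Y, hY]

theorem pow_dvd_of_map_eq_zero (hker : ∀ r, θ r = 0 → (p : F) ^ e ∣ r)
    (hX : ∀ i, f (locX F n i) = locX F' n i)
    (hY : ∀ i, f (locY F n i) = locY F' n i)
    (hC : ∀ r, f (algebraMap F _ r) = algebraMap F' _ (θ r)) {d : WeylLoc F n} (hd : f d = 0) :
    (p : WeylLoc F n) ^ e ∣ d := by
  obtain ⟨s, hs, a, hsa⟩ := exists_of_mul_eq_of d
  obtain ⟨g, rfl⟩ := normalOrder_surjective a
  have h0 := congrArg f hsa
  rw [map_mul, hd, mul_zero, map_of_normalOrder hX hY hC] at h0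
  have h1 : MvPolynomial.map θ g = 0 := normalOrder_injective <| of_injective <| by
    rw [← h0, map_zero, map_zero]
  have h2 : ((p ^ e : ℕ) : MvPolynomial (Fin n ⊕ Fin n) F) ∣ g :=
    IsTruncated.natCast_dvd_iff.2 fun γ => by
      rw [Nat.cast_pow]
      exact hker _ (by rw [← coeff_map, h1, coeff_zero])
  obtain ⟨g', rfl⟩ := h2
  rw [← Nat.cast_pow]
  exact dvd_of_of_mul_eq (isUnit_of hs) hsa ⟨_, normalOrder_natCast_mul _ g'⟩

theorem map_surjective (h : IsTruncated p m F) (h' : IsTruncated p e F') (hp : p.Prime)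
    (hθ : Function.Surjective θ)
    (hX : ∀ i, f (locX F n i) = locX F' n i)
    (hY : ∀ i, f (locY F n i) = locY F' n i)
    (hC : ∀ r, f (algebraMap F _ r) = algebraMap F' _ (θ r)) :
    Function.Surjective f := by
  intro d
  have hq : ((p ^ (m + e) : ℕ) : F) = 0 := h.natCast_pow_eq_zero_of_le (by lia)
  have hq' : ((p ^ (m + e) : ℕ) : F') = 0 := h'.natCast_pow_eq_zero_of_le (by lia)
  have hq0 : 0 < p ^ (m + e) := pow_pos hp.pos _
  obtain ⟨c', a', hc', hca⟩ := exists_of_powHom_mul_eq_of h' hq' hq0 d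
  obtain ⟨c, rfl⟩ := MvPolynomial.map_surjective θ hθ c'
  obtain ⟨g', rfl⟩ := normalOrder_surjective a'
  obtain ⟨g, rfl⟩ := MvPolynomial.map_surjective θ hθ g'
  have hc : ¬ (p : MvPolynomial (Fin n ⊕ Fin n) F) ∣ c := fun hd => hc' <| by
    simpa using map_dvd (MvPolynomial.map θ) hd
  obtain ⟨u, hu⟩ := isUnit_of_powHom h hq hq0 hc
  refine ⟨↑u⁻¹ * of F n (normalOrder F n g), ?_⟩
  refine (isUnit_of_powHom h' hq' hq0 hc').mul_left_cancel ?_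
  rw [hca, powHom_apply, ← map_expand, ← map_of_normalOrder hX hY hC, ← powHom_apply hq, ← hu,
    ← map_mul, Units.mul_inv_cancel_left, map_of_normalOrder hX hY hC]

theorem map_mem_ratSubfield (hX : ∀ i, f (locX F n i) = locX F' n i)
    (hY : ∀ i, f (locY F n i) = locY F' n i)
    (hC : ∀ r, f (algebraMap F _ r) = algebraMap F' _ (θ r)) {z : WeylLoc F n}
    (hz : z ∈ ratSubfield F n q) : f z ∈ ratSubfield F' n q := by
  suffices ratSubfield F n q ≤ (ratSubfield F' n q).comap f from this hz
  refine divClosure_le ?_ fun x hx y hxy hyx => ?_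
  · rintro _ ((⟨r, rfl⟩ | ⟨i, rfl⟩) | ⟨i, rfl⟩) <;> refine subset_divClosure ?_
    · exact .inl (.inl ⟨θ r, (hC r).symm⟩)
    · exact .inl (.inr ⟨i, by simp [hX]⟩)
    · exact .inr ⟨i, by simp [hY]⟩
  · exact inv_mem_divClosure (x := f x) hx (by rw [← map_mul, hxy, map_one])
      (by rw [← map_mul, hyx, map_one])

theorem isUnit_of_map_eq_one (h : IsTruncated p m F) (hker : ∀ d, f d = 0 → (p : WeylLoc F n) ∣ d)
    {d : WeylLoc F n} (hd : f d = 1) : IsUnit d := by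
  obtain ⟨w, hw⟩ := hker (d - 1) (by rw [map_sub, hd, map_one, sub_self])
  have : IsNilpotent (d - 1) := ⟨m, by
    rw [hw, (Nat.cast_commute p w).mul_pow, natCast_pow_eq_zero h, zero_mul]⟩
  simpa using this.isUnit_add_one

theorem exists_map_eq_of_mem_ratSubfield (h : IsTruncated p m F) (hθ : Function.Surjective θ)
    (hker : ∀ d, f d = 0 → (p : WeylLoc F n) ∣ d) (hf : Function.Surjective f)
    (hX : ∀ i, f (locX F n i) = locX F' n i)
    (hY : ∀ i, f (locY F n i) = locY F' n i)
    (hC : ∀ r, f (algebraMap F _ r) = algebraMap F' _ (θ r)) {z : WeylLoc F' n}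
    (hz : z ∈ ratSubfield F' n q) : ∃ a ∈ ratSubfield F n q, f a = z := by
  suffices ratSubfield F' n q ≤ (ratSubfield F n q).map f from this hz
  refine divClosure_le ?_ ?_
  · rintro _ ((⟨r, rfl⟩ | ⟨i, rfl⟩) | ⟨i, rfl⟩)
    · obtain ⟨r, rfl⟩ := hθ r
      exact ⟨_, subset_divClosure (.inl (.inl ⟨r, rfl⟩)), hC r⟩
    · exact ⟨_, subset_divClosure (.inl (.inr ⟨i, rfl⟩)), by simp [hX]⟩
    · exact ⟨_, subset_divClosure (.inr ⟨i, rfl⟩), by simp [hY]⟩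
  · rintro _ ⟨a, ha, rfl⟩ y hxy hyx
    obtain ⟨b, rfl⟩ := hf y
    rw [← map_mul] at hxy hyx
    have h1 := isUnit_of_map_eq_one h hker hxy
    have h2 := isUnit_of_map_eq_one h hker hyx
    obtain ⟨u, rfl⟩ : IsUnit a := by
      obtain ⟨v, hv⟩ := h1
      obtain ⟨w, hw⟩ := h2
      have hr : a * (b * ↑v⁻¹) = 1 := by rw [← mul_assoc, ← hv, Units.mul_inv]
      have hl : (↑w⁻¹ * b) * a = 1 := by rw [mul_assoc, ← hw, Units.inv_mul]
      exact ⟨⟨a, b * ↑v⁻¹, hr, by rwa [← left_inv_eq_right_inv hl hr]⟩, rfl⟩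
    refine ⟨↑u⁻¹, inv_mem_divClosure ha u.mul_inv u.inv_mul, ?_⟩
    refine left_inv_eq_right_inv (a := f u) (by rw [← map_mul, Units.inv_mul, map_one]) ?_
    rw [← map_mul, hxy]

/-- The center as an extension of rational functions in the `p^m`-th powers by `p` times the lifts
of the center of the reduction modulo `p^(m-1)`. -/
theorem mem_center_iff_exists (h : IsTruncated p m F) (h' : IsTruncated p (m - 1) F') (hp : p.Prime)
    (hker : ∀ d, f d = 0 → (p : WeylLoc F n) ^ (m - 1) ∣ d) (hf : Function.Surjective f)
    (z : WeylLoc F n) : z ∈ Subring.center (WeylLoc F n) ↔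
      ∃ a ∈ ratSubfield F n (p ^ m), ∃ w, f w ∈ Subring.center (WeylLoc F' n) ∧ z = a + p * w := by
  have hcenter (w : WeylLoc F n) : (p : WeylLoc F n) * w ∈ Subring.center (WeylLoc F n) ↔
      f w ∈ Subring.center (WeylLoc F' n) := by
    have key (d : WeylLoc F n) :
        d * (p * w) - p * w * d = (p : WeylLoc F n) * (d * w - w * d) := by
      rw [← mul_assoc d, ← Nat.cast_comm p d]; noncomm_ring
    simp only [Subring.mem_center_iff, hf.forall]
    refine forall_congr' fun d => ?_
    rw [← sub_eq_zero, key, ← map_mul, ← map_mul, ← sub_eq_zero (b := f (w * d)), ← map_sub]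
    refine ⟨fun hd => ?_, fun hd => ?_⟩
    · obtain ⟨v, hv⟩ := pow_dvd_of_mul_eq_zero h h.pos (by rwa [pow_one])
      rw [hv, map_mul, map_pow, map_natCast, natCast_pow_eq_zero h', zero_mul]
    · obtain ⟨v, hv⟩ := hker _ hd
      rw [hv, ← mul_assoc, ← pow_succ', Nat.sub_add_cancel h.pos, natCast_pow_eq_zero h, zero_mul]
  have hle := ratSubfield_le_center (n := n) h.natCast_pow_eq_zero
  constructor
  · intro hz
    obtain ⟨a, ha, w, rfl⟩ := exists_eq_add_of_mem_center h hp hz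
    refine ⟨a, ha, w, (hcenter w).1 ?_, rfl⟩
    simpa using sub_mem hz (hle ha)
  · rintro ⟨a, ha, w, hw, rfl⟩
    exact add_mem (hle ha) ((hcenter w).2 hw)

end Reduction

end WeylLoc

theorem IsTruncated.of_charP {p : ℕ} {k : Type*} [Field k] [CharP k p] : IsTruncated p 1 k where
  pos := one_pos
  pow_eq_zero := by simp
  not_dvd_one := by simp
  dvd_or_dvd a b := by simp
  pow_dvd_of_mul_eq_zero j hj a ha := by
    interval_cases j
    · simp_all
    · simp

section TruncWitt

variable {p m : ℕ} [Fact p.Prime] {k : Type*}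

theorem WittVector.prime_natCast [Field k] [CharP k p] [PerfectRing k p] :
    Prime (p : WittVector p k) :=
  (WittVector.irreducible p).prime

theorem TruncWitt.natCast_dvd_mk_iff [CommRing k] (hm : 0 < m) (a : WittVector p k) :
    (p : TruncWitt p k m) ∣ Ideal.Quotient.mk _ a ↔ (p : WittVector p k) ∣ a := by
  refine ⟨?_, fun h => by simpa using map_dvd (Ideal.Quotient.mk _) h⟩
  rintro ⟨c, hc⟩
  obtain ⟨c, rfl⟩ := Ideal.Quotient.mk_surjective c
  rw [← map_natCast (Ideal.Quotient.mk _), ← map_mul, Ideal.Quotient.eq,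
    Ideal.mem_span_singleton] at hc
  exact (dvd_sub_left (dvd_mul_right _ c)).1 ((dvd_pow_self _ hm.ne').trans hc)

theorem IsTruncated.truncWitt [Field k] [CharP k p] [PerfectRing k p] (hm : 0 < m) :
    IsTruncated p m (TruncWitt p k m) where
  pos := hm
  pow_eq_zero := by
    rw [← map_natCast (Ideal.Quotient.mk _), ← map_pow, Ideal.Quotient.eq_zero_iff_mem]
    exact Ideal.mem_span_singleton_self _
  not_dvd_one h := WittVector.prime_natCast.not_dvd_one ((TruncWitt.natCast_dvd_mk_iff hm 1).1 h)
  dvd_or_dvd a b := by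
    obtain ⟨a, rfl⟩ := Ideal.Quotient.mk_surjective a
    obtain ⟨b, rfl⟩ := Ideal.Quotient.mk_surjective b
    rw [← map_mul]
    simp only [TruncWitt.natCast_dvd_mk_iff hm]
    exact WittVector.prime_natCast.dvd_or_dvd
  pow_dvd_of_mul_eq_zero j hj a ha := by
    obtain ⟨a, rfl⟩ := Ideal.Quotient.mk_surjective a
    rw [← map_natCast (Ideal.Quotient.mk _), ← map_pow, ← map_mul, Ideal.Quotient.eq_zero_iff_mem,
      Ideal.mem_span_singleton, ← Nat.add_sub_cancel' hj, pow_add,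
      mul_dvd_mul_iff_left (pow_ne_zero _ WittVector.prime_natCast.ne_zero)] at ha
    rw [← map_natCast (Ideal.Quotient.mk _), ← map_pow]
    exact map_dvd _ ha

/-- The reduction `W_m → W_l` for `l ≤ m`. -/
noncomputable def TruncWitt.factor (p : ℕ) [Fact p.Prime] (k : Type*) [CommRing k] {l m : ℕ}
    (h : l ≤ m) : TruncWitt p k m →+* TruncWitt p k l :=
  Ideal.Quotient.factor (Ideal.span_singleton_le_span_singleton.2 (pow_dvd_pow _ h))

theorem TruncWitt.factor_surjective [CommRing k] {l : ℕ} (h : l ≤ m) :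
    Function.Surjective (TruncWitt.factor p k h) :=
  Ideal.Quotient.factor_surjective _

theorem TruncWitt.pow_dvd_of_factor_eq_zero [CommRing k] {l : ℕ} (h : l ≤ m) (r : TruncWitt p k m)
    (hr : TruncWitt.factor p k h r = 0) : (p : TruncWitt p k m) ^ l ∣ r := by
  obtain ⟨r, rfl⟩ := Ideal.Quotient.mk_surjective r
  rw [TruncWitt.factor, Ideal.Quotient.factor_mk, Ideal.Quotient.eq_zero_iff_mem,
    Ideal.mem_span_singleton] at hr
  simpa using map_dvd (Ideal.Quotient.mk (Ideal.span {(p : WittVector p k) ^ m})) hr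

/-- The reduction modulo `p` of a truncated Witt ring, onto the residue field. -/
noncomputable def TruncWitt.residue (p : ℕ) [Fact p.Prime] (k : Type*) [CommRing k] [CharP k p]
    {m : ℕ} (hm : 0 < m) : TruncWitt p k m →+* k :=
  Ideal.Quotient.lift _ WittVector.constantCoeff fun a ha => by
    obtain ⟨b, rfl⟩ := Ideal.mem_span_singleton.1 ha
    rw [map_mul, map_pow, map_natCast, CharP.cast_eq_zero, zero_pow hm.ne', zero_mul]

theorem TruncWitt.residue_surjective [CommRing k] [CharP k p] (hm : 0 < m) :
    Function.Surjective (TruncWitt.residue p k hm) :=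
  Ideal.Quotient.lift_surjective_of_surjective _ _ (WittVector.constantCoeff_surjective p)

theorem TruncWitt.dvd_of_residue_eq_zero [Field k] [CharP k p] [PerfectRing k p] (hm : 0 < m)
    (r : TruncWitt p k m) (hr : TruncWitt.residue p k hm r = 0) : (p : TruncWitt p k m) ∣ r := by
  obtain ⟨r, rfl⟩ := Ideal.Quotient.mk_surjective r
  rw [TruncWitt.residue, Ideal.Quotient.lift_mk] at hr
  exact (TruncWitt.natCast_dvd_mk_iff hm r).2 <| Ideal.mem_span_singleton.1 <|
    (WittVector.mem_span_p_iff_coeff_zero_eq_zero r).2 hr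

end TruncWitt

/-- Lemma (center): (a) `Z₁ = K₁`: the center of the division ring of fractions `D_p` of
`A_n(k)` (`char k = p`) is `k(xᵢᵖ, yᵢᵖ)`;  (b) for `m ≥ 2`, `Z_m = K_m + p·Z_{m−1}` under
the natural reduction `ψ : D_{pᵐ} → D_{pᵐ⁻¹}`; (c) consequently, the image of the center
`Z_m` of `D_{pᵐ}` under the reduction `φ : D_{pᵐ} → D_p` modulo `p` is the subfield
`Z^{p^{m−1}} = k(xᵢ^{pᵐ}, yᵢ^{pᵐ})`. -/
theorem stmt15 (p n m : ℕ) [Fact p.Prime] (hm : 2 ≤ m)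
    (k : Type*) [Field k] [IsAlgClosed k] [CharP k p]
    [OreLocalization.OreSet (nonZeroDivisors (WeylAlgebra (TruncWitt p k m) n))]
    [OreLocalization.OreSet (nonZeroDivisors (WeylAlgebra (TruncWitt p k (m - 1)) n))]
    [OreLocalization.OreSet (nonZeroDivisors (WeylAlgebra k n))] :
    -- (a) `Z₁ = K₁ = k(xᵢᵖ, yᵢᵖ)`
    (Subring.center (WeylLoc k n) = ratSubfield k n p) ∧
    -- (b) `Z_m = K_m + p Z_{m-1}` under the natural reduction `D_{pᵐ} → D_{pᵐ⁻¹}`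
    (∀ ψ : WeylLoc (TruncWitt p k m) n →+* WeylLoc (TruncWitt p k (m - 1)) n,
      (∀ i, ψ (locX (TruncWitt p k m) n i) = locX (TruncWitt p k (m - 1)) n i) →
      (∀ i, ψ (locY (TruncWitt p k m) n i) = locY (TruncWitt p k (m - 1)) n i) →
      (∀ w : WittVector p k,
        ψ (algebraMap (TruncWitt p k m) (WeylLoc (TruncWitt p k m) n)
            (Ideal.Quotient.mk (Ideal.span {(p : WittVector p k) ^ m}) w)) =
          algebraMap (TruncWitt p k (m - 1)) (WeylLoc (TruncWitt p k (m - 1)) n)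
            (Ideal.Quotient.mk (Ideal.span {(p : WittVector p k) ^ (m - 1)}) w)) →
      (Subring.center (WeylLoc (TruncWitt p k m) n) : Set (WeylLoc (TruncWitt p k m) n)) =
        {z : WeylLoc (TruncWitt p k m) n |
          ∃ a ∈ ratSubfield (TruncWitt p k m) n (p ^ m),
          ∃ w : WeylLoc (TruncWitt p k m) n,
            ψ w ∈ Subring.center (WeylLoc (TruncWitt p k (m - 1)) n) ∧
            z = a + (p : WeylLoc (TruncWitt p k m) n) * w}) ∧
    -- (c) the image of `Z_m` modulo `p` is `Z^{p^{m-1}} = k(xᵢ^{pᵐ}, yᵢ^{pᵐ})`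
    (∀ φ : WeylLoc (TruncWitt p k m) n →+* WeylLoc k n,
      (∀ i, φ (locX (TruncWitt p k m) n i) = locX k n i) →
      (∀ i, φ (locY (TruncWitt p k m) n i) = locY k n i) →
      (∀ w : WittVector p k,
        φ (algebraMap (TruncWitt p k m) (WeylLoc (TruncWitt p k m) n)
            (Ideal.Quotient.mk (Ideal.span {(p : WittVector p k) ^ m}) w)) =
          algebraMap k (WeylLoc k n) (WittVector.constantCoeff w)) →
      φ '' (Subring.center (WeylLoc (TruncWitt p k m) n) : Set (WeylLoc (TruncWitt p k m) n)) =
        (ratSubfield k n (p ^ m) : Set (WeylLoc k n))) := by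
  have hm0 : 0 < m := by lia
  have hp : p.Prime := Fact.out
  have hF : IsTruncated p m (TruncWitt p k m) := .truncWitt hm0
  have hk : IsTruncated p 1 k := .of_charP
  refine ⟨WeylLoc.center_eq_ratSubfield hk hp, fun ψ hX hY hW => ?_, fun φ hX hY hW => ?_⟩
  · have hF' : IsTruncated p (m - 1) (TruncWitt p k (m - 1)) := .truncWitt (Nat.sub_pos_of_lt hm)
    have hC : ∀ r, ψ (algebraMap _ _ r) =
        algebraMap _ _ (TruncWitt.factor p k (m.sub_le 1) r) :=
      Ideal.Quotient.mk_surjective.forall.2 hW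
    exact Set.ext <| WeylLoc.mem_center_iff_exists hF hF' hp
      (fun d => WeylLoc.pow_dvd_of_map_eq_zero
        (TruncWitt.pow_dvd_of_factor_eq_zero _) hX hY hC)
      (WeylLoc.map_surjective hF hF' hp (TruncWitt.factor_surjective _) hX hY hC)
  · have hC : ∀ r, φ (algebraMap _ _ r) = algebraMap _ _ (TruncWitt.residue p k hm0 r) :=
      Ideal.Quotient.mk_surjective.forall.2 hW
    have hker (d) (hd : φ d = 0) : (p : WeylLoc (TruncWitt p k m) n) ∣ d := by
      simpa using WeylLoc.pow_dvd_of_map_eq_zero (p := p) (e := 1)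
        (by simpa using TruncWitt.dvd_of_residue_eq_zero hm0) hX hY hC hd
    have hθ := TruncWitt.residue_surjective (p := p) (k := k) hm0
    refine Set.Subset.antisymm ?_ fun z hz => ?_
    · rintro _ ⟨z, hz, rfl⟩
      obtain ⟨a, ha, w, rfl⟩ := WeylLoc.exists_eq_add_of_mem_center hF hp hz
      rw [map_add, map_mul, map_natCast, WeylLoc.natCast_eq_zero (CharP.cast_eq_zero k p), zero_mul,
        add_zero]
      exact WeylLoc.map_mem_ratSubfield hX hY hC ha
    · obtain ⟨a, ha, rfl⟩ := WeylLoc.exists_map_eq_of_mem_ratSubfield hF hθ hker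
        (WeylLoc.map_surjective hF hk hp hθ hX hY hC) hX hY hC hz
      exact ⟨a, WeylLoc.ratSubfield_le_center hF.natCast_pow_eq_zero ha, rfl⟩
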